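/- For every positive integer n, and every 0 ≤ k ≤ 48 and ℓ ≥ 0 with k and ℓ not both zero, one has ‖2^k·3^ℓ‖ = 2k + 3ℓ. -/

import Mathlib

/-- `CanWrite n k` means the positive integer `n` can be written using exactly `k` ones
combined by addition and multiplication. -/
inductive CanWrite : ℕ → ℕ → Prop
  | one : CanWrite 1 1
  | add {a b j k : ℕ} : CanWrite a j → CanWrite b k → CanWrite (a + b) (j + k)
  | mul {a b j k : ℕ} : CanWrite a j → CanWrite b k → CanWrite (a * b) (j + k)

/-- The integer complexity `‖n‖`: the least number of ones needed to write `n`. -/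
noncomputable def cpx (n : ℕ) : ℕ := sInf {k | CanWrite n k}

/-- The defect `δ(n) = ‖n‖ - 3 log₃ n`. -/
noncomputable def defect (n : ℕ) : ℝ := (cpx n : ℝ) - 3 * Real.logb 3 n

/-- `n` is stable if `‖3^k n‖ = 3k + ‖n‖` for all `k ≥ 0`. -/
def Stable (n : ℕ) : Prop := ∀ k : ℕ, cpx (3 ^ k * n) = 3 * k + cpx n

/-- The stabilization length `K(n)`: the least `k` such that `3^k n` is stable. -/
noncomputable def stabLen (n : ℕ) : ℕ := sInf {k | Stable (3 ^ k * n)}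

/-- The stable complexity `‖n‖_st`: equal to `‖3^k n‖ - 3k` for any `k` with `3^k n` stable. -/
noncomputable def stableCpx (n : ℕ) : ℕ :=
  sInf {m | ∃ k : ℕ, Stable (3 ^ k * n) ∧ cpx (3 ^ k * n) = m + 3 * k}

/-- The stable defect `δ_st(n) = ‖n‖_st - 3 log₃ n`. -/
noncomputable def stableDefect (n : ℕ) : ℝ := (stableCpx n : ℝ) - 3 * Real.logb 3 n


/-- Complexities of `0, …, 106` (with the junk value `0` at `0`). -/
def tblL : List ℕ := [0, 1, 2, 3, 4, 5, 5, 6, 6, 6, 7, 8, 7, 8, 8, 8, 8, 9, 8, 9, 9, 9, 10, 11, 9, 10, 10, 9, 10, 11, 10, 11, 10, 11, 11, 11, 10, 11, 11, 11, 11, 12, 11, 12, 12, 11, 12, 13, 11, 12, 12, 12, 12, 13, 11, 12, 12, 12, 13, 14, 12, 13, 13, 12, 12, 13, 13, 14, 13, 14, 13, 14, 12, 13, 13, 13, 13, 14, 13, 14, 13, 12, 13, 14, 13, 14, 14, 14, 14, 15, 13, 14, 14, 14, 15, 14, 13, 14, 14, 14, 14, 15, 14, 15, 14, 14, 15]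

def tbl (n : ℕ) : ℕ := tblL.getD n 0

/-- Small numbers that are optimal-ish sums, with the cost as a sum, sorted by defect. -/
def spor : List (ℕ × ℕ) := [(3, 3), (2, 2), (4, 4), (5, 5), (7, 6), (10, 7), (28, 10), (19, 9), (82, 13), (13, 8), (9, 7), (55, 12), (6, 6), (37, 11), (25, 10), (17, 9), (73, 13), (8, 7), (49, 12), (16, 9), (11, 8), (33, 11), (97, 14), (46, 12), (22, 10)]

def sporAll (halt f : ℕ → ℕ → Bool) : List (ℕ × ℕ) → Bool
  | [] => true
  | x :: t => halt x.1 x.2 || (f x.1 x.2 && sporAll halt f t)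

/-- `allBelow f n` checks `f 0, …, f (n-1)`. -/
def allBelow (f : ℕ → Bool) (n : ℕ) : Bool :=
  Nat.rec true (fun i ih => f i && ih) n

/-- Concrete checker. -/
def chk (fuel : ℕ) : ℕ → ℕ → Bool :=
  Nat.rec (fun _ _ => false)
    (fun _ ih n c =>
      Nat.blt (3 ^ c) (n ^ 3) ||
      (bif Nat.ble n 106 then Nat.blt c (tbl n) else
        Nat.ble (3 ^ c) (32 * n ^ 3) &&
        (ih (n - 1) (c - 1) && (ih (n - 2) (c - 2) && (ih (n - 3) (c - 3) &&
        (sporAll (fun s cs => Nat.blt (s ^ 6 * 3 ^ c) (9 ^ cs * n ^ 3))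
          (fun s cs => !(Nat.beq (n % s) 0) || ih (n / s) (c - cs)) spor &&
        (Nat.blt (2 * 3 ^ c) (17 * n ^ 3) ||
          allBelow (fun a =>
            Nat.blt (2 * 64 ^ a * 3 ^ c) (17 * 81 ^ a * n ^ 3) ||
            allBelow (fun l =>
              Nat.blt (2 ^ a * 3 ^ l) 106 || !(Nat.beq (n % (2 ^ a * 3 ^ l + 1)) 0) ||
                ih (n / (2 ^ a * 3 ^ l + 1)) (c - (2 * a + 3 * l + 1))) (c / 3 + 1)) 6))))))) fuel

/-- The checks for sums `A + B = 2 ^ k * 3 ^ l`. -/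
def rootChk (k l : ℕ) : Bool :=
  allBelow (fun b => Nat.ble (2 ^ k * 3 ^ l) (b + 1) ||
    chk 200 (2 ^ k * 3 ^ l - (b + 1)) (2 * k + 3 * l - 1 - tbl (b + 1))) 9

/-- No `n = 2 ^ a * 3 ^ l`, `a ≤ 5`, has `M ∣ q * n + p`. -/
def leafOk (q p M : ℕ) : Bool :=
  Nat.blt 0 (q % 3) && (Nat.blt (Nat.gcd p (Nat.gcd M (3 ^ 60))) (Nat.gcd M (3 ^ 60)) &&
    allBelow (fun a => Nat.blt 0 ((q * (2 ^ a * Nat.gcd p (Nat.gcd M (3 ^ 60))) + p) % M)) 6)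

/-- Modular checker. -/
def mchk (fuel : ℕ) : ℕ → ℕ → ℕ → ℕ → Bool :=
  Nat.rec (fun _ _ _ _ => false)
    (fun _ ih q p M r =>
      Nat.blt r 1000000 || ((Nat.ble r 1940000 && leafOk q p M) ||
      (Nat.ble 1 p && (Nat.ble 1 q && (Nat.ble (p + q * 10000) M && (Nat.ble r 32000000 &&
      (ih q (p + q * 1) M (r * 1001 / (3 ^ 1 * 1000) + 1) &&
      (ih q (p + q * 2) M (r * 1001 / (3 ^ 2 * 1000) + 1) &&
      (ih q (p + q * 3) M (r * 1001 / (3 ^ 3 * 1000) + 1) &&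
      (sporAll (fun s cs => Nat.blt (r * s ^ 6) (1000000 * 9 ^ cs))
        (fun s cs => !(Nat.beq (p % Nat.gcd (q * s) M) 0) ||
          ih (q * s / Nat.gcd (q * s) M) (p / Nat.gcd (q * s) M) (M / Nat.gcd (q * s) M)
            (r * s ^ 3 / 3 ^ cs + 1)) spor &&
      (Nat.blt (2 * r) 17000000 ||
        allBelow (fun a =>
          Nat.blt (2 * 64 ^ a * r) (17 * 81 ^ a * 1000000) ||
          (fun L1 => Nat.ble 3001 (3 ^ L1) &&
          (ih q p (Nat.gcd M (2 ^ a * 3 ^ L1)) (r * (8 ^ a * 1001) / (3 * 9 ^ a * 1000) + 1) &&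
          allBelow (fun l =>
            Nat.blt (2 ^ a * 3 ^ l) 106 || !(Nat.beq (p % Nat.gcd (q * (2 ^ a * 3 ^ l + 1)) M) 0) ||
            ih (q * (2 ^ a * 3 ^ l + 1) / Nat.gcd (q * (2 ^ a * 3 ^ l + 1)) M)
              (p / Nat.gcd (q * (2 ^ a * 3 ^ l + 1)) M) (M / Nat.gcd (q * (2 ^ a * 3 ^ l + 1)) M)
              (r * (2 ^ a * 3 ^ l + 1) ^ 3 / 3 ^ (2 * a + 3 * l + 1) + 1)) L1))
            ((2 * Nat.log2 q + Nat.log2 M) * 100 / 475 + 5)) 6))))))))))) fuel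

/-! ### Basic facts -/

/-- `W n c`: `n` can be written with at most `c` ones. -/
def W (n c : ℕ) : Prop := ∃ c' ≤ c, CanWrite n c'

theorem CanWrite.pos {n c : ℕ} (h : CanWrite n c) : 1 ≤ n ∧ 1 ≤ c := by
  induction h with
  | one => simp
  | add _ _ h1 h2 => omega
  | mul _ _ h1 h2 => exact ⟨Nat.mul_pos h1.1 h2.1, by omega⟩

theorem cube_aux {a i : ℕ} (hi : 1 ≤ i) (ha : a ^ 3 ≤ 3 ^ i) : (a + 1) ^ 3 ≤ 3 ^ (i + 1) := by
  rw [pow_succ 3 i]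
  rcases Nat.lt_or_ge a 3 with h | h
  · interval_cases a
    · have : 3 ^ 1 ≤ 3 ^ i := Nat.pow_le_pow_right (by norm_num) hi
      omega
    · have : 3 ^ 1 ≤ 3 ^ i := Nat.pow_le_pow_right (by norm_num) hi
      omega
    · have hi2 : 2 ≤ i := by
        by_contra hc
        have : i = 1 := by omega
        subst this; norm_num at ha
      have : 3 ^ 2 ≤ 3 ^ i := Nat.pow_le_pow_right (by norm_num) hi2
      omega
  · obtain ⟨t, rfl⟩ := Nat.exists_eq_add_of_le h
    have : (3 + t + 1) ^ 3 ≤ (3 + t) ^ 3 * 3 := by nlinarith [sq_nonneg t, pow_nonneg (Nat.zero_le t) 3]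
    omega

theorem CanWrite.cube {n c : ℕ} (h : CanWrite n c) : n ^ 3 ≤ 3 ^ c := by
  induction h with
  | one => norm_num
  | @add a b i j ha hb h1 h2 =>
    have pa := ha.pos
    have pb := hb.pos
    rcases Nat.lt_or_ge b 2 with hb2 | hb2
    · have : b = 1 := by omega
      subst this
      calc (a + 1) ^ 3 ≤ 3 ^ (i + 1) := cube_aux pa.2 h1
        _ ≤ 3 ^ (i + j) := Nat.pow_le_pow_right (by norm_num) (by omega)
    rcases Nat.lt_or_ge a 2 with ha2 | ha2
    · have : a = 1 := by omega
      subst this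
      calc (1 + b) ^ 3 = (b + 1) ^ 3 := by ring
        _ ≤ 3 ^ (j + 1) := cube_aux pb.2 h2
        _ ≤ 3 ^ (i + j) := Nat.pow_le_pow_right (by norm_num) (by omega)
    · calc (a + b) ^ 3 ≤ (a * b) ^ 3 := Nat.pow_le_pow_left (by nlinarith) 3
        _ = a ^ 3 * b ^ 3 := by ring
        _ ≤ 3 ^ i * 3 ^ j := Nat.mul_le_mul h1 h2
        _ = 3 ^ (i + j) := (pow_add _ _ _).symm
  | @mul a b i j ha hb h1 h2 =>
    calc (a * b) ^ 3 = a ^ 3 * b ^ 3 := by ring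
        _ ≤ 3 ^ i * 3 ^ j := Nat.mul_le_mul h1 h2
        _ = 3 ^ (i + j) := (pow_add _ _ _).symm

theorem W.mono {n c d : ℕ} (h : W n c) (hd : c ≤ d) : W n d := by
  obtain ⟨c', h1, h2⟩ := h
  exact ⟨c', h1.trans hd, h2⟩

theorem W.pos {n c : ℕ} (h : W n c) : 1 ≤ n ∧ 1 ≤ c := by
  obtain ⟨c', h1, h2⟩ := h
  have := h2.pos
  omega

theorem W.cube {n c : ℕ} (h : W n c) : n ^ 3 ≤ 3 ^ c := by
  obtain ⟨c', h1, h2⟩ := h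
  exact h2.cube.trans (Nat.pow_le_pow_right (by norm_num) h1)

theorem W.mul {a b i j : ℕ} (ha : W a i) (hb : W b j) : W (a * b) (i + j) := by
  obtain ⟨c, h1, h2⟩ := ha
  obtain ⟨d, h3, h4⟩ := hb
  exact ⟨c + d, by omega, h2.mul h4⟩

/-! ### Decomposition into sums -/

/-- `n` is a sum with total cost at most `c`. -/
def Sol (n c : ℕ) : Prop :=
  ∃ A B i j, B ≤ A ∧ W A i ∧ W B j ∧ A + B = n ∧ i + j ≤ c

theorem Sol.w {n c : ℕ} (h : Sol n c) : W n c := by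
  obtain ⟨A, B, i, j, -, ⟨i', hi, hA⟩, ⟨j', hj, hB⟩, rfl, hc⟩ := h
  exact ⟨i' + j', by omega, hA.add hB⟩

/-- `n` is `1` or has a sum factor of least defect. -/
def Dec (n c : ℕ) : Prop :=
  n = 1 ∨ ∃ s m i j, s * m = n ∧ i + j ≤ c ∧ Sol s i ∧
    ((m = 1 ∧ j = 0) ∨ (W m j ∧ 3 ^ i * m ^ 3 ≤ 3 ^ j * s ^ 3))

theorem Dec.mono {n c d : ℕ} (h : Dec n c) (hd : c ≤ d) : Dec n d := by
  rcases h with h | ⟨s, m, i, j, h1, h2, h3⟩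
  · exact Or.inl h
  · exact Or.inr ⟨s, m, i, j, h1, h2.trans hd, h3⟩

theorem dec_mul_aux {P i Q j s₁ m₁ i₁ j₁ s₂ m₂ i₂ j₂ : ℕ} (hQ : W Q j)
    (e1 : s₁ * m₁ = P) (l1 : i₁ + j₁ ≤ i) (S1 : Sol s₁ i₁)
    (c1 : (m₁ = 1 ∧ j₁ = 0) ∨ (W m₁ j₁ ∧ 3 ^ i₁ * m₁ ^ 3 ≤ 3 ^ j₁ * s₁ ^ 3))
    (e2 : s₂ * m₂ = Q) (l2 : i₂ + j₂ ≤ j)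
    (c2 : (m₂ = 1 ∧ j₂ = 0) ∨ (W m₂ j₂ ∧ 3 ^ i₂ * m₂ ^ 3 ≤ 3 ^ j₂ * s₂ ^ 3))
    (hle : 3 ^ i₁ * s₂ ^ 3 ≤ 3 ^ i₂ * s₁ ^ 3) : Dec (P * Q) (i + j) := by
  have m1c : m₁ ^ 3 ≤ 3 ^ j₁ := by
    rcases c1 with ⟨rfl, rfl⟩ | ⟨h, -⟩
    · norm_num
    · exact h.cube
  have m2c : m₂ ^ 3 ≤ 3 ^ j₂ := by
    rcases c2 with ⟨rfl, rfl⟩ | ⟨h, -⟩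
    · norm_num
    · exact h.cube
  refine Or.inr ⟨s₁, m₁ * Q, i₁, j₁ + j, by rw [← e1]; ring, by omega, S1, Or.inr ⟨?_, ?_⟩⟩
  · rcases c1 with ⟨rfl, rfl⟩ | ⟨h, -⟩
    · simpa using hQ
    · exact h.mul hQ
  · have h3 : 3 ^ i₂ * 3 ^ j₂ ≤ 3 ^ j := by
      rw [← pow_add]; exact Nat.pow_le_pow_right (by norm_num) l2
    calc 3 ^ i₁ * (m₁ * Q) ^ 3 = (3 ^ i₁ * s₂ ^ 3) * (m₁ ^ 3 * m₂ ^ 3) := by rw [← e2]; ring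
      _ ≤ (3 ^ i₂ * s₁ ^ 3) * (3 ^ j₁ * 3 ^ j₂) :=
        Nat.mul_le_mul hle (Nat.mul_le_mul m1c m2c)
      _ = 3 ^ j₁ * (3 ^ i₂ * 3 ^ j₂) * s₁ ^ 3 := by ring
      _ ≤ 3 ^ j₁ * 3 ^ j * s₁ ^ 3 := by gcongr
      _ = 3 ^ (j₁ + j) * s₁ ^ 3 := by rw [pow_add]

theorem CanWrite.dec {n c : ℕ} (h : CanWrite n c) : Dec n c := by
  induction h with
  | one => exact Or.inl rfl
  | @add a b i j ha hb h1 h2 =>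
    refine Or.inr ⟨a + b, 1, i + j, 0, by ring, le_rfl, ?_, Or.inl ⟨rfl, rfl⟩⟩
    rcases le_total b a with hab | hab
    · exact ⟨a, b, i, j, hab, ⟨i, le_rfl, ha⟩, ⟨j, le_rfl, hb⟩, rfl, le_rfl⟩
    · exact ⟨b, a, j, i, hab, ⟨j, le_rfl, hb⟩, ⟨i, le_rfl, ha⟩, by ring, by omega⟩
  | @mul a b i j ha hb h1 h2 =>
    rcases h1 with rfl | ⟨s₁, m₁, i₁, j₁, e1, l1, S1, c1⟩
    · rw [one_mul]; exact h2.mono (by omega)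
    rcases h2 with rfl | ⟨s₂, m₂, i₂, j₂, e2, l2, S2, c2⟩
    · rw [mul_one]
      exact Dec.mono (Or.inr ⟨s₁, m₁, i₁, j₁, e1, l1, S1, c1⟩) (by omega)
    rcases le_total (3 ^ i₁ * s₂ ^ 3) (3 ^ i₂ * s₁ ^ 3) with hle | hle
    · exact dec_mul_aux ⟨j, le_rfl, hb⟩ e1 l1 S1 c1 e2 l2 c2 hle
    · rw [mul_comm a b, add_comm i j]
      exact dec_mul_aux ⟨i, le_rfl, ha⟩ e2 l2 S2 c2 e1 l1 c1 hle

/-! ### Small numbers -/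

theorem tbl_add : ∀ a < 107, ∀ b < 107, a + b < 107 → 1 ≤ a → 1 ≤ b →
    tbl (a + b) ≤ tbl a + tbl b := by decide +kernel

theorem tbl_mul : ∀ a < 107, ∀ b < 107, a * b < 107 → 1 ≤ a → 1 ≤ b →
    tbl (a * b) ≤ tbl a + tbl b := by decide +kernel

theorem CanWrite.tbl_le {n c : ℕ} (h : CanWrite n c) : n < 107 → tbl n ≤ c := by
  induction h with
  | one => intro _; decide
  | @add a b i j ha hb h1 h2 =>
    intro h
    have pa := ha.pos
    have pb := hb.pos
    have := tbl_add a (by omega) b (by omega) h pa.1 pb.1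
    have := h1 (by omega)
    have := h2 (by omega)
    omega
  | @mul a b i j ha hb h1 h2 =>
    intro h
    have pa := ha.pos
    have pb := hb.pos
    have la : a < 107 := lt_of_le_of_lt (Nat.le_mul_of_pos_right a pb.1) h
    have lb : b < 107 := lt_of_le_of_lt (Nat.le_mul_of_pos_left b pa.1) h
    have := tbl_mul a la b lb h pa.1 pb.1
    have := h1 la
    have := h2 lb
    omega

theorem W.tbl_le {n c : ℕ} (h : W n c) (hn : n < 107) : tbl n ≤ c := by
  obtain ⟨c', h1, h2⟩ := h
  exact (h2.tbl_le hn).trans h1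

theorem spor_small' : ∀ A < 107, ∀ B < 107,
    (A + B < 107 ∧ 1 ≤ A ∧ 1 ≤ B ∧ 9 ^ (tbl A + tbl B) ≤ 32 * (A + B) ^ 6) →
    spor.any (fun x => decide (x.1 = A + B ∧ x.2 ≤ tbl A + tbl B)) = true := by decide +kernel

theorem spor_small {A B : ℕ} (h : A + B < 107) (hA : 1 ≤ A) (hB : 1 ≤ B)
    (h9 : 9 ^ (tbl A + tbl B) ≤ 32 * (A + B) ^ 6) :
    ∃ x ∈ spor, x.1 = A + B ∧ x.2 ≤ tbl A + tbl B := by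
  have := spor_small' A (by omega) B (by omega) ⟨h, hA, hB, h9⟩
  rw [List.any_eq_true] at this
  obtain ⟨x, hx, hp⟩ := this
  exact ⟨x, hx, of_decide_eq_true hp⟩

theorem smooth_small : ∀ n < 107, 1 ≤ n → 100 * 3 ^ tbl n ≤ 194 * n ^ 3 →
    ∃ a < 7, ∃ l < 6, n = 2 ^ a * 3 ^ l ∧ 2 * a + 3 * l ≤ tbl n := by decide +kernel

/-- If `3 ^ y * A ^ 3 ≤ C * (A + B) ^ 3` with `B ≤ A` then `3 ^ y ≤ 8 * C`. -/
theorem half_bound {A B y C : ℕ} (hA : 1 ≤ A) (hBA : B ≤ A)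
    (h : 3 ^ y * A ^ 3 ≤ C * (A + B) ^ 3) : 3 ^ y ≤ 8 * C := by
  have h1 : (A + B) ^ 3 ≤ (2 * A) ^ 3 := Nat.pow_le_pow_left (by omega) 3
  have h2 : 3 ^ y * A ^ 3 ≤ (8 * C) * A ^ 3 := by
    calc 3 ^ y * A ^ 3 ≤ C * (A + B) ^ 3 := h
      _ ≤ C * (2 * A) ^ 3 := Nat.mul_le_mul le_rfl h1
      _ = (8 * C) * A ^ 3 := by ring
  exact Nat.le_of_mul_le_mul_right h2 (by positivity)

theorem exp_lt {y z C : ℕ} (h : 3 ^ y ≤ C) (hz : C < 3 ^ z) : y < z :=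
  (Nat.pow_lt_pow_iff_right (by norm_num : 1 < 3)).1 (lt_of_le_of_lt h hz)

/-- A number of cost at most `y ≤ 6` is small. -/
theorem small_cost {B y : ℕ} (hB : W B y) (hy : y ≤ 6) : B < 10 ∧ tbl B ≤ y := by
  have h1 := hB.cube
  have h2 : 3 ^ y ≤ 3 ^ 6 := Nat.pow_le_pow_right (by norm_num) hy
  have h3 : B < 10 := by
    by_contra hc
    have : 10 ^ 3 ≤ B ^ 3 := Nat.pow_le_pow_left (by omega) 3
    omega
  exact ⟨h3, hB.tbl_le (by omega)⟩

theorem tbl_ge : ∀ B < 10, (B ≤ 3 → tbl B = B) ∧ (tbl B ≤ 3 → B ≤ 3) ∧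
    (tbl B ≤ 4 → tbl B = B) := by decide

/-- Numbers of very small defect. -/
theorem CanWrite.smooth {n c : ℕ} (h : CanWrite n c) : 100 * 3 ^ c ≤ 194 * n ^ 3 →
    ∃ a l, n = 2 ^ a * 3 ^ l ∧ 2 * a + 3 * l ≤ c := by
  induction h with
  | one => intro h; norm_num at h
  | @add a b i j ha hb h1 h2 =>
    intro h
    rcases Nat.lt_or_ge (a + b) 107 with hs | hs
    · have ht := (ha.add hb).tbl_le hs
      have h3 : 3 ^ tbl (a + b) ≤ 3 ^ (i + j) := Nat.pow_le_pow_right (by norm_num) ht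
      obtain ⟨x, -, y, -, h4, h5⟩ := smooth_small (a + b) hs (by have := ha.pos; omega) (by omega)
      exact ⟨x, y, h4, by omega⟩
    · exfalso
      have key : ∀ A B x y : ℕ, B ≤ A → CanWrite A x → CanWrite B y → 107 ≤ A + B →
          100 * 3 ^ (x + y) ≤ 194 * (A + B) ^ 3 → False := by
        intro A B x y hBA hA hB hs h
        have h3 : 3 ^ y * A ^ 3 * 100 ≤ 194 * (A + B) ^ 3 := by
          have : 3 ^ y * A ^ 3 ≤ 3 ^ y * 3 ^ x := Nat.mul_le_mul le_rfl hA.cube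
          rw [pow_add] at h
          nlinarith
        have h4 : 3 ^ y * A ^ 3 ≤ 2 * (A + B) ^ 3 := by omega
        have h5 := exp_lt (z := 3) (half_bound (by omega) hBA h4) (by norm_num)
        have h6 := small_cost ⟨y, le_rfl, hB⟩ (by omega)
        have h7 := (tbl_ge B h6.1).2.1 (by omega)
        have h8 := (tbl_ge B h6.1).1 h7
        have hy := hB.pos.2
        have h9 : 3 ^ 1 ≤ 3 ^ y := Nat.pow_le_pow_right (by norm_num) hy
        have h10 : 3 * A ^ 3 * 100 ≤ 194 * (A + 3) ^ 3 := by
          calc 3 * A ^ 3 * 100 ≤ 3 ^ y * A ^ 3 * 100 := by gcongr; omega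
            _ ≤ _ := h3
            _ ≤ _ := by gcongr
        obtain ⟨t, rfl⟩ := Nat.exists_eq_add_of_le (show 53 ≤ A by omega)
        nlinarith [sq_nonneg t, pow_nonneg (Nat.zero_le t) 3]
      rcases le_total b a with hab | hab
      · exact key a b i j hab ha hb hs h
      · exact key b a j i hab hb ha (by omega) (by rwa [add_comm j i, add_comm b a])
  | @mul a b i j ha hb h1 h2 =>
    intro h
    have ca := ha.cube
    have cb := hb.cube
    have pa := ha.pos.1
    have pb := hb.pos.1
    have e : 100 * (3 ^ i * 3 ^ j) ≤ 194 * (a ^ 3 * b ^ 3) := by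
      rw [← pow_add, ← mul_pow]; exact h
    obtain ⟨x, y, e1, l1⟩ := h1 (by
      have : (100 * 3 ^ i) * b ^ 3 ≤ (194 * a ^ 3) * b ^ 3 := by
        calc (100 * 3 ^ i) * b ^ 3 ≤ (100 * 3 ^ i) * 3 ^ j := Nat.mul_le_mul le_rfl cb
          _ = 100 * (3 ^ i * 3 ^ j) := by ring
          _ ≤ _ := e
          _ = _ := by ring
      exact Nat.le_of_mul_le_mul_right this (by positivity))
    obtain ⟨z, w, e2, l2⟩ := h2 (by
      have : (100 * 3 ^ j) * a ^ 3 ≤ (194 * b ^ 3) * a ^ 3 := by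
        calc (100 * 3 ^ j) * a ^ 3 ≤ (100 * 3 ^ j) * 3 ^ i := Nat.mul_le_mul le_rfl ca
          _ = 100 * (3 ^ i * 3 ^ j) := by ring
          _ ≤ _ := e
          _ = _ := by ring
      exact Nat.le_of_mul_le_mul_right this (by positivity))
    exact ⟨x + z, y + w, by rw [e1, e2, pow_add, pow_add]; ring, by omega⟩

theorem W.smooth {n c : ℕ} (h : W n c) (hc : 100 * 3 ^ c ≤ 194 * n ^ 3) :
    ∃ a l, a ≤ 5 ∧ n = 2 ^ a * 3 ^ l ∧ 2 * a + 3 * l ≤ c := by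
  obtain ⟨c', h1, h2⟩ := h
  have h3 : 3 ^ c' ≤ 3 ^ c := Nat.pow_le_pow_right (by norm_num) h1
  obtain ⟨a, l, e, hl⟩ := h2.smooth (by omega)
  refine ⟨a, l, ?_, e, by omega⟩
  by_contra ha
  have h4 : 3 ^ (2 * a + 3 * l) ≤ 3 ^ c := Nat.pow_le_pow_right (by norm_num) (by omega)
  have h5 : (100 * 9 ^ a) * 27 ^ l ≤ (194 * 8 ^ a) * 27 ^ l := by
    calc (100 * 9 ^ a) * 27 ^ l = 100 * 3 ^ (2 * a + 3 * l) := by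
          rw [pow_add, pow_mul, pow_mul]; norm_num; ring
      _ ≤ 100 * 3 ^ c := by omega
      _ ≤ 194 * n ^ 3 := hc
      _ = 194 * ((2 ^ 3) ^ a * (3 ^ 3) ^ l) := by
          rw [e, mul_pow, ← pow_mul, ← pow_mul, ← pow_mul, ← pow_mul, mul_comm a, mul_comm l]
      _ = _ := by norm_num; ring
  have h6 := Nat.le_of_mul_le_mul_right h5 (by positivity)
  obtain ⟨t, rfl⟩ := Nat.exists_eq_add_of_le (show 6 ≤ a by omega)
  have h7 : 8 ^ t ≤ 9 ^ t := Nat.pow_le_pow_left (by norm_num) t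
  have h8 : 0 < 8 ^ t := by positivity
  rw [pow_add, pow_add] at h6
  norm_num at h6
  nlinarith

/-! ### The one-step analysis -/

theorem sum_step {n c : ℕ} (h : Sol n c) (hn : 107 ≤ n) (hc : 3 ^ c ≤ 32 * n ^ 3) :
    ∃ m B c', 1 ≤ B ∧ B ≤ 3 ∧ n = m + B ∧ c' + B ≤ c ∧ W m c' := by
  obtain ⟨A, B, i, j, hBA, hA, hB, rfl, hij⟩ := h
  have h1 : 3 ^ j * A ^ 3 ≤ 32 * (A + B) ^ 3 := by
    calc 3 ^ j * A ^ 3 ≤ 3 ^ j * 3 ^ i := Nat.mul_le_mul le_rfl hA.cube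
      _ = 3 ^ (i + j) := by rw [pow_add, mul_comm]
      _ ≤ 3 ^ c := Nat.pow_le_pow_right (by norm_num) hij
      _ ≤ _ := hc
  have h2 := exp_lt (z := 6) (half_bound (by omega) hBA h1) (by norm_num)
  have h3 := small_cost hB (by omega)
  have h4 : j ≤ 3 := by
    by_contra hj
    have h5 : 3 ^ 4 ≤ 3 ^ j := Nat.pow_le_pow_right (by norm_num) (by omega)
    have h6 : 81 * A ^ 3 ≤ 32 * (A + 9) ^ 3 := by
      calc 81 * A ^ 3 ≤ 3 ^ j * A ^ 3 := by gcongr; omega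
        _ ≤ _ := h1
        _ ≤ _ := by gcongr; omega
    obtain ⟨t, rfl⟩ := Nat.exists_eq_add_of_le (show 53 ≤ A by omega)
    nlinarith [sq_nonneg t, pow_nonneg (Nat.zero_le t) 3]
  have h7 := (tbl_ge B h3.1).2.1 (by omega)
  have h8 := (tbl_ge B h3.1).1 h7
  have hp := hB.pos.1
  exact ⟨A, B, i, hp, h7, rfl, by omega, hA⟩

theorem six_bound (A : ℕ) (hA : 106 ≤ A) : 32 * (A + 1) ^ 6 * 10000 ≤ 9 * 37636 * A ^ 6 := by
  have h1 : 5657 * (A + 1) ^ 3 ≤ 5820 * A ^ 3 := by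
    obtain ⟨t, rfl⟩ := Nat.exists_eq_add_of_le hA
    nlinarith [sq_nonneg t, pow_nonneg (Nat.zero_le t) 3]
  have h2 : (5657 * (A + 1) ^ 3) ^ 2 ≤ (5820 * A ^ 3) ^ 2 := Nat.pow_le_pow_left h1 2
  have e1 : (5657 * (A + 1) ^ 3) ^ 2 = 32001649 * (A + 1) ^ 6 := by ring
  have e2 : (5820 * A ^ 3) ^ 2 = 33872400 * A ^ 6 := by ring
  omega

/-- Sums of small defect are on the list or of the form `2 ^ a * 3 ^ l + 1`. -/
theorem sol_class {s i : ℕ} (h : Sol s i) (hs : 9 ^ i ≤ 32 * s ^ 6) :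
    (∃ x ∈ spor, x.1 = s ∧ x.2 ≤ i) ∨
    (∃ a l, a ≤ 5 ∧ 106 ≤ 2 ^ a * 3 ^ l ∧ s = 2 ^ a * 3 ^ l + 1 ∧ 2 * a + 3 * l + 1 ≤ i) := by
  obtain ⟨A, B, x, y, hBA, hA, hB, rfl, hij⟩ := h
  have pA := hA.pos
  have pB := hB.pos
  rcases Nat.lt_or_ge (A + B) 107 with hsm | hsm
  · left
    have t1 := hA.tbl_le (by omega)
    have t2 := hB.tbl_le (by omega)
    have h1 : 9 ^ (tbl A + tbl B) ≤ 9 ^ i := Nat.pow_le_pow_right (by norm_num) (by omega)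
    obtain ⟨z, hz, e, hl⟩ := spor_small hsm pA.1 pB.1 (h1.trans hs)
    exact ⟨z, hz, e, by omega⟩
  · right
    have hA6 : A ^ 6 ≤ 9 ^ x := by
      calc A ^ 6 = (A ^ 3) ^ 2 := by ring
        _ ≤ (3 ^ x) ^ 2 := Nat.pow_le_pow_left hA.cube 2
        _ = 9 ^ x := by rw [← pow_mul, mul_comm, pow_mul]; norm_num
    have h0 : 9 ^ y * 9 ^ x ≤ 32 * (A + B) ^ 6 := by
      calc 9 ^ y * 9 ^ x = 9 ^ (x + y) := by rw [pow_add, mul_comm]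
        _ ≤ 9 ^ i := Nat.pow_le_pow_right (by norm_num) hij
        _ ≤ _ := hs
    have h1 : 9 ^ y * A ^ 6 ≤ 32 * (A + B) ^ 6 := (Nat.mul_le_mul le_rfl hA6).trans h0
    have h2 : 9 ^ y * A ^ 6 ≤ 2048 * A ^ 6 := by
      calc 9 ^ y * A ^ 6 ≤ 32 * (A + B) ^ 6 := h1
        _ ≤ 32 * (2 * A) ^ 6 := by gcongr; omega
        _ = _ := by ring
    have h3 : 9 ^ y ≤ 2048 := Nat.le_of_mul_le_mul_right h2 (Nat.pow_pos pA.1)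
    have hy : y < 4 := (Nat.pow_lt_pow_iff_right (by norm_num : 1 < 9)).1 (lt_of_le_of_lt h3 (by norm_num))
    have h4 := small_cost hB (by omega)
    have h5 := (tbl_ge B h4.1).2.1 (by omega)
    have h6 := (tbl_ge B h4.1).1 h5
    have hy1 : y = 1 := by
      by_contra hne
      have h7 : 9 ^ 2 ≤ 9 ^ y := Nat.pow_le_pow_right (by norm_num) (by omega)
      have h8 : 81 * A ^ 6 ≤ 32 * (A + 3) ^ 6 := by
        calc 81 * A ^ 6 ≤ 9 ^ y * A ^ 6 := by gcongr; omega
          _ ≤ _ := h1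
          _ ≤ _ := by gcongr
      have h9 : 2 * (A + 3) ^ 3 ≤ 3 * A ^ 3 := by
        obtain ⟨t, rfl⟩ := Nat.exists_eq_add_of_le (show 53 ≤ A by omega)
        nlinarith [sq_nonneg t, pow_nonneg (Nat.zero_le t) 3]
      have h10 : (2 * (A + 3) ^ 3) ^ 2 ≤ (3 * A ^ 3) ^ 2 := Nat.pow_le_pow_left h9 2
      have h11 : 0 < A ^ 6 := Nat.pow_pos pA.1
      have e1 : (2 * (A + 3) ^ 3) ^ 2 = 4 * (A + 3) ^ 6 := by ring
      have e2 : (3 * A ^ 3) ^ 2 = 9 * A ^ 6 := by ring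
      omega
    subst hy1
    have hB1 : B = 1 := by omega
    subst hB1
    have h7 : (100 * 3 ^ x) ^ 2 ≤ (194 * A ^ 3) ^ 2 := by
      have h8 := six_bound A (by omega)
      have e1 : (100 * 3 ^ x) ^ 2 = 10000 * 9 ^ x := by
        rw [mul_pow, ← pow_mul, mul_comm x, pow_mul]; norm_num
      have e2 : (194 * A ^ 3) ^ 2 = 37636 * A ^ 6 := by ring
      rw [e1, e2]
      omega
    have h8 : 100 * 3 ^ x ≤ 194 * A ^ 3 := (Nat.pow_le_pow_iff_left (by norm_num)).1 h7
    obtain ⟨a, l, ha, e, hl⟩ := hA.smooth h8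
    exact ⟨a, l, ha, by omega, by omega, by omega⟩

theorem step {n c : ℕ} (h : W n c) (hn : 107 ≤ n) (hc : 3 ^ c ≤ 32 * n ^ 3) :
    (∃ m B c', 1 ≤ B ∧ B ≤ 3 ∧ n = m + B ∧ c' + B ≤ c ∧ W m c') ∨
    (∃ x ∈ spor, ∃ m c', n = x.1 * m ∧ c' + x.2 ≤ c ∧ W m c' ∧ 9 ^ x.2 * n ^ 3 ≤ x.1 ^ 6 * 3 ^ c) ∨
    (∃ a l m c', a ≤ 5 ∧ 106 ≤ 2 ^ a * 3 ^ l ∧ n = (2 ^ a * 3 ^ l + 1) * m ∧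
      c' + (2 * a + 3 * l + 1) ≤ c ∧ W m c' ∧ 17 * 81 ^ a * n ^ 3 ≤ 2 * 64 ^ a * 3 ^ c) := by
  obtain ⟨c₀, hc₀, hw⟩ := h
  have hc₁ : 3 ^ c₀ ≤ 3 ^ c := Nat.pow_le_pow_right (by norm_num) hc₀
  rcases hw.dec with h1 | ⟨s, m, i, j, rfl, hij, hS, ⟨rfl, rfl⟩ | ⟨hm, hle⟩⟩
  · omega
  · left
    rw [mul_one] at hc hn ⊢
    obtain ⟨m, B, c', q1, q2, q3, q4, q5⟩ := sum_step hS hn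
      ((Nat.pow_le_pow_right (by norm_num) (by omega)).trans hc)
    exact ⟨m, B, c', q1, q2, q3, by omega, q5⟩
  · right
    have ps := hS.w.pos.1
    have pm := hm.pos.1
    have e9 : 9 ^ i = 3 ^ i * 3 ^ i := by rw [← mul_pow]; norm_num
    have k1 : 9 ^ i * (s * m) ^ 3 ≤ s ^ 6 * 3 ^ c := by
      calc 9 ^ i * (s * m) ^ 3 = (3 ^ i * m ^ 3) * (3 ^ i * s ^ 3) := by rw [e9]; ring
        _ ≤ (3 ^ j * s ^ 3) * (3 ^ i * s ^ 3) := Nat.mul_le_mul hle le_rfl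
        _ = s ^ 6 * 3 ^ (i + j) := by rw [pow_add]; ring
        _ ≤ s ^ 6 * 3 ^ c := Nat.mul_le_mul le_rfl (Nat.pow_le_pow_right (by norm_num) (by omega))
    have k2 : 9 ^ i ≤ 32 * s ^ 6 := by
      have : 9 ^ i * (s * m) ^ 3 ≤ (32 * s ^ 6) * (s * m) ^ 3 := by
        calc _ ≤ s ^ 6 * 3 ^ c := k1
          _ ≤ s ^ 6 * (32 * (s * m) ^ 3) := Nat.mul_le_mul le_rfl hc
          _ = _ := by ring
      exact Nat.le_of_mul_le_mul_right this (by positivity)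
    rcases sol_class hS k2 with ⟨x, hx, rfl, hxi⟩ | ⟨a, l, ha, hal, rfl, hcost⟩
    · left
      refine ⟨x, hx, m, j, rfl, by omega, hm, le_trans ?_ k1⟩
      exact Nat.mul_le_mul (Nat.pow_le_pow_right (by norm_num) hxi) le_rfl
    · right
      refine ⟨a, l, m, j, ha, hal, rfl, by omega, hm, ?_⟩
      generalize hN : ((2 ^ a * 3 ^ l + 1) * m) ^ 3 = N at k1
      have hA : 17 * (2 ^ a * 3 ^ l + 1) ^ 6 ≤ 18 * (2 ^ a * 3 ^ l) ^ 6 := by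
        have := six_bound (2 ^ a * 3 ^ l) hal
        omega
      have e81 : 9 ^ (2 * a + 3 * l + 1) * 64 ^ a = 9 * 81 ^ a * (2 ^ a * 3 ^ l) ^ 6 := by
        have e1 : 9 ^ (2 * a + 3 * l + 1) = 81 ^ a * 729 ^ l * 9 := by
          rw [pow_add, pow_add, pow_mul, pow_mul]; norm_num
        have e2 : (2 ^ a * 3 ^ l) ^ 6 = 64 ^ a * 729 ^ l := by
          rw [mul_pow, ← pow_mul, ← pow_mul, mul_comm a, mul_comm l, pow_mul, pow_mul]; norm_num
        rw [e1, e2]; ring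
      have k3 : 9 ^ (2 * a + 3 * l + 1) * N ≤ (2 ^ a * 3 ^ l + 1) ^ 6 * 3 ^ c :=
        le_trans (Nat.mul_le_mul (Nat.pow_le_pow_right (by norm_num) hcost) le_rfl) k1
      generalize (2 ^ a * 3 ^ l) = A at *
      have hA0 : 0 < 9 * A ^ 6 := by positivity
      refine Nat.le_of_mul_le_mul_right (c := 9 * A ^ 6) ?_ hA0
      calc 17 * 81 ^ a * N * (9 * A ^ 6) = 17 * N * (9 * 81 ^ a * A ^ 6) := by ring
        _ = 17 * 64 ^ a * (9 ^ (2 * a + 3 * l + 1) * N) := by rw [← e81]; ring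
        _ ≤ 17 * 64 ^ a * ((A + 1) ^ 6 * 3 ^ c) := Nat.mul_le_mul le_rfl k3
        _ = 64 ^ a * 3 ^ c * (17 * (A + 1) ^ 6) := by ring
        _ ≤ 64 ^ a * 3 ^ c * (18 * A ^ 6) := Nat.mul_le_mul le_rfl hA
        _ = _ := by ring

/-! ### Soundness of the checkers -/

theorem allBelow_spec {f : ℕ → Bool} {n : ℕ} (h : allBelow f n = true) :
    ∀ i < n, f i = true := by
  induction n with
  | zero => intro i hi; omega
  | succ n ih =>
    have h' : (f n && allBelow f n) = true := h
    rw [Bool.and_eq_true] at h'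
    intro i hi
    rcases Nat.lt_succ_iff_lt_or_eq.1 hi with h1 | h1
    · exact ih h'.2 i h1
    · rw [h1]; exact h'.1

theorem spor_sorted : spor.Pairwise (fun x y => 9 ^ x.2 * y.1 ^ 6 ≤ 9 ^ y.2 * x.1 ^ 6) := by
  decide +kernel

theorem spor_pos : ∀ x ∈ spor, 1 ≤ x.1 := by decide

theorem sporAll_spec_aux {halt f : ℕ → ℕ → Bool} {T N : ℕ}
    (hs : ∀ s cs, halt s cs = true → s ^ 6 * T < 9 ^ cs * N) (L : List (ℕ × ℕ))
    (hp : L.Pairwise (fun x y => 9 ^ x.2 * y.1 ^ 6 ≤ 9 ^ y.2 * x.1 ^ 6))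
    (hpos : ∀ x ∈ L, 1 ≤ x.1)
    (h : sporAll halt f L = true) : ∀ x ∈ L, 9 ^ x.2 * N ≤ x.1 ^ 6 * T → f x.1 x.2 = true := by
  induction L with
  | nil => intro x hx; simp at hx
  | cons y t ih =>
    intro x hx hxT
    simp only [sporAll, Bool.or_eq_true, Bool.and_eq_true] at h
    rw [List.pairwise_cons] at hp
    rcases h with h | h
    · exfalso
      have h1 := hs _ _ h
      rcases List.mem_cons.1 hx with rfl | hx'
      · omega
      · have h2 := hp.1 x hx'
        have hy : 0 < y.1 ^ 6 := Nat.pow_pos (hpos y (by simp))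
        have hx0 : 0 < x.1 ^ 6 := Nat.pow_pos (hpos x hx)
        have h3 : x.1 ^ 6 * (y.1 ^ 6 * T) < x.1 ^ 6 * (9 ^ y.2 * N) :=
          Nat.mul_lt_mul_of_pos_left h1 hx0
        have h4 : (9 ^ y.2 * x.1 ^ 6) * N ≤ (9 ^ x.2 * y.1 ^ 6) * N :=
          Nat.mul_le_mul h2 le_rfl
        have h5 : y.1 ^ 6 * (9 ^ x.2 * N) ≤ y.1 ^ 6 * (x.1 ^ 6 * T) := Nat.mul_le_mul le_rfl hxT
        nlinarith
    · rcases List.mem_cons.1 hx with rfl | hx'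
      · exact h.1
      · exact ih hp.2 (fun x hx => hpos x (by simp [hx])) h.2 x hx' hxT

theorem sporAll_spec {halt f : ℕ → ℕ → Bool} {T N : ℕ}
    (hs : ∀ s cs, halt s cs = true → s ^ 6 * T < 9 ^ cs * N)
    (h : sporAll halt f spor = true) :
    ∀ x ∈ spor, 9 ^ x.2 * N ≤ x.1 ^ 6 * T → f x.1 x.2 = true :=
  sporAll_spec_aux hs spor spor_sorted spor_pos h

theorem chk_succ (f n c : ℕ) : chk (f + 1) n c =
      (Nat.blt (3 ^ c) (n ^ 3) ||
      (bif Nat.ble n 106 then Nat.blt c (tbl n) else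
        Nat.ble (3 ^ c) (32 * n ^ 3) &&
        (chk f (n - 1) (c - 1) && (chk f (n - 2) (c - 2) && (chk f (n - 3) (c - 3) &&
        (sporAll (fun s cs => Nat.blt (s ^ 6 * 3 ^ c) (9 ^ cs * n ^ 3))
          (fun s cs => !(Nat.beq (n % s) 0) || chk f (n / s) (c - cs)) spor &&
        (Nat.blt (2 * 3 ^ c) (17 * n ^ 3) ||
          allBelow (fun a =>
            Nat.blt (2 * 64 ^ a * 3 ^ c) (17 * 81 ^ a * n ^ 3) ||
            allBelow (fun l =>
              Nat.blt (2 ^ a * 3 ^ l) 106 || !(Nat.beq (n % (2 ^ a * 3 ^ l + 1)) 0) ||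
                chk f (n / (2 ^ a * 3 ^ l + 1)) (c - (2 * a + 3 * l + 1)))
                  (c / 3 + 1)) 6))))))) := rfl

theorem blt_iff {a b : ℕ} : Nat.blt a b = true ↔ a < b := by
  simp [Nat.blt, Nat.ble_eq]

theorem not_beq_zero {a b : ℕ} : (!(Nat.beq (a % b) 0)) = true ↔ a % b ≠ 0 := by
  cases h : Nat.beq (a % b) 0
  · simp; intro h1; rw [h1] at h; simp at h
  · simp; exact Nat.eq_of_beq_eq_true h

theorem guard_aux {a n T : ℕ} (h : 17 * 81 ^ a * n ≤ 2 * 64 ^ a * T) : 17 * n ≤ 2 * T := by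
  have h1 : 64 ^ a ≤ 81 ^ a := Nat.pow_le_pow_left (by norm_num) a
  have h2 : 81 ^ a * (17 * n) ≤ 81 ^ a * (2 * T) := by
    have : 64 ^ a * (2 * T) ≤ 81 ^ a * (2 * T) := Nat.mul_le_mul h1 le_rfl
    nlinarith
  exact Nat.le_of_mul_le_mul_left h2 (by positivity)

theorem chk_sound (f : ℕ) : ∀ n c, chk f n c = true → ¬ W n c := by
  induction f with
  | zero => intro n c h; exact absurd h (by simp [chk])
  | succ f ih =>
    intro n c h hW
    rw [chk_succ] at h
    rw [Bool.or_eq_true, blt_iff] at h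
    have hcube := hW.cube
    replace h := h.resolve_left (by omega)
    rcases Nat.lt_or_ge n 107 with hn | hn
    · have e : Nat.ble n 106 = true := by rw [Nat.ble_eq]; omega
      rw [e, cond_true, blt_iff] at h
      have := hW.tbl_le hn
      omega
    · have e : Nat.ble n 106 = false := by
        rw [← Bool.not_eq_true, Nat.ble_eq]; omega
      rw [e, cond_false] at h
      simp only [Bool.and_eq_true, Nat.ble_eq] at h
      obtain ⟨h32, h1, h2, h3, hsp, hfam⟩ := h
      rcases step hW hn h32 with ⟨m, B, c', hB1, hB3, e, hc, hm⟩ | ⟨x, hx, m, c', e, hc, hm, h9⟩ |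
          ⟨a, l, m, c', ha, hal, e, hc, hm, h17⟩
      · have em : m = n - B := by omega
        have hm' : W (n - B) (c - B) := em ▸ hm.mono (by omega)
        interval_cases B
        · exact ih _ _ h1 hm'
        · exact ih _ _ h2 hm'
        · exact ih _ _ h3 hm'
      · have := sporAll_spec (T := 3 ^ c) (N := n ^ 3)
          (fun s cs hs => blt_iff.1 hs) hsp x hx h9
        rw [Bool.or_eq_true, not_beq_zero] at this
        have hx0 := spor_pos x hx
        rcases this with h | h
        · exact h (by rw [e]; exact Nat.mul_mod_right _ _)
        · refine ih _ _ h ?_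
          rw [e, Nat.mul_div_cancel_left _ hx0]
          exact hm.mono (by omega)
      · rw [Bool.or_eq_true, blt_iff] at hfam
        have hg := guard_aux h17
        replace hfam := allBelow_spec (hfam.resolve_left (by omega)) a (by omega)
        rw [Bool.or_eq_true, blt_iff] at hfam
        replace hfam := allBelow_spec (hfam.resolve_left (by omega)) l (by omega)
        rw [Bool.or_eq_true, Bool.or_eq_true, blt_iff, not_beq_zero] at hfam
        rcases hfam with (h | h) | h
        · omega
        · exact h (by rw [e]; exact Nat.mul_mod_right _ _)
        · refine ih _ _ h ?_
          rw [e, Nat.mul_div_cancel_left _ (by omega)]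
          exact hm.mono (by omega)

theorem leafOk_sound {q p M a l : ℕ} (h : leafOk q p M = true) (ha : a ≤ 5)
    (hd : M ∣ q * (2 ^ a * 3 ^ l) + p) : False := by
  simp only [leafOk, Bool.and_eq_true, blt_iff] at h
  obtain ⟨hq, hg, hall⟩ := h
  set g := Nat.gcd M (3 ^ 60) with hgdef
  have hgM : g ∣ M := Nat.gcd_dvd_left _ _
  obtain ⟨t, -, ht⟩ := (Nat.dvd_prime_pow Nat.prime_three).1 (Nat.gcd_dvd_right M (3 ^ 60))
  obtain ⟨u, hu, hu'⟩ := (Nat.dvd_prime_pow Nat.prime_three).1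
    (show Nat.gcd p g ∣ 3 ^ t by rw [← ht]; exact Nat.gcd_dvd_right _ _)
  rw [← hgdef] at ht
  have hut : u < t := by
    rw [hu', ht] at hg
    exact (Nat.pow_lt_pow_iff_right (by norm_num)).1 hg
  have hq3 : Nat.Coprime 3 (q * 2 ^ a) := by
    rw [Nat.Prime.coprime_iff_not_dvd Nat.prime_three]
    intro h3
    rcases (Nat.Prime.dvd_mul Nat.prime_three).1 h3 with h | h
    · omega
    · have := Nat.prime_three.dvd_of_dvd_pow h
      omega
  have hup : 3 ^ u ∣ p := by rw [← hu']; exact Nat.gcd_dvd_left _ _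
  have hgd : 3 ^ t ∣ q * (2 ^ a * 3 ^ l) + p := ht ▸ hgM.trans hd
  have hlu : l = u := by
    rcases Nat.lt_trichotomy l u with h | h | h
    · exfalso
      have h1 : 3 ^ u ∣ q * (2 ^ a * 3 ^ l) :=
        (Nat.dvd_add_left hup).1 ((pow_dvd_pow 3 hu).trans hgd)
      rw [← mul_assoc] at h1
      have h2 := (Nat.Coprime.pow_left u hq3).dvd_of_dvd_mul_left h1
      have := Nat.pow_dvd_pow_iff_le_right' |>.1 h2
      omega
    · exact h
    · exfalso
      have h1 : 3 ^ (u + 1) ∣ q * (2 ^ a * 3 ^ l) :=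
        ((pow_dvd_pow 3 h).mul_left _).mul_left _
      have h2 : 3 ^ (u + 1) ∣ p :=
        (Nat.dvd_add_right h1).1 ((pow_dvd_pow 3 hut).trans hgd)
      have h3 : 3 ^ (u + 1) ∣ Nat.gcd p g := Nat.dvd_gcd h2 (by rw [ht]; exact pow_dvd_pow 3 hut)
      rw [hu'] at h3
      have := Nat.pow_dvd_pow_iff_le_right' |>.1 h3
      omega
  have := allBelow_spec hall a (by omega)
  rw [blt_iff, hu', ← hlu, Nat.mod_eq_zero_of_dvd hd] at this
  omega

theorem mchk_succ (f q p M r : ℕ) : mchk (f + 1) q p M r =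
      (Nat.blt r 1000000 || ((Nat.ble r 1940000 && leafOk q p M) ||
      (Nat.ble 1 p && (Nat.ble 1 q && (Nat.ble (p + q * 10000) M && (Nat.ble r 32000000 &&
      (mchk f q (p + q * 1) M (r * 1001 / (3 ^ 1 * 1000) + 1) &&
      (mchk f q (p + q * 2) M (r * 1001 / (3 ^ 2 * 1000) + 1) &&
      (mchk f q (p + q * 3) M (r * 1001 / (3 ^ 3 * 1000) + 1) &&
      (sporAll (fun s cs => Nat.blt (r * s ^ 6) (1000000 * 9 ^ cs))
        (fun s cs => !(Nat.beq (p % Nat.gcd (q * s) M) 0) ||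
          mchk f (q * s / Nat.gcd (q * s) M) (p / Nat.gcd (q * s) M) (M / Nat.gcd (q * s) M)
            (r * s ^ 3 / 3 ^ cs + 1)) spor &&
      (Nat.blt (2 * r) 17000000 ||
        allBelow (fun a =>
          Nat.blt (2 * 64 ^ a * r) (17 * 81 ^ a * 1000000) ||
          (fun L1 => Nat.ble 3001 (3 ^ L1) &&
          (mchk f q p (Nat.gcd M (2 ^ a * 3 ^ L1)) (r * (8 ^ a * 1001) / (3 * 9 ^ a * 1000) + 1) &&
          allBelow (fun l =>
            Nat.blt (2 ^ a * 3 ^ l) 106 || !(Nat.beq (p % Nat.gcd (q * (2 ^ a * 3 ^ l + 1)) M) 0) ||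
            mchk f (q * (2 ^ a * 3 ^ l + 1) / Nat.gcd (q * (2 ^ a * 3 ^ l + 1)) M)
              (p / Nat.gcd (q * (2 ^ a * 3 ^ l + 1)) M) (M / Nat.gcd (q * (2 ^ a * 3 ^ l + 1)) M)
              (r * (2 ^ a * 3 ^ l + 1) ^ 3 / 3 ^ (2 * a + 3 * l + 1) + 1)) L1))
            ((2 * Nat.log2 q + Nat.log2 M) * 100 / 475 + 5)) 6))))))))))) := rfl

theorem div_bound {x y z d : ℕ} (hd : 0 < d) (h : x * d ≤ y * z) : x ≤ (y / d + 1) * z := by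
  have h1 : y ≤ (y / d + 1) * d := (Nat.lt_mul_of_div_lt (Nat.lt_succ_self _) hd).le
  have h2 : x * d ≤ ((y / d + 1) * z) * d := by
    calc x * d ≤ y * z := h
      _ ≤ ((y / d + 1) * d) * z := Nat.mul_le_mul h1 le_rfl
      _ = ((y / d + 1) * z) * d := by ring
  exact Nat.le_of_mul_le_mul_right h2 hd

/-- Passing to a factor, divisibility part. -/
theorem factor_dvd {q p M s m : ℕ} (hM : 0 < M) (h : M ∣ q * (s * m) + p) :
    p % Nat.gcd (q * s) M = 0 ∧
    M / Nat.gcd (q * s) M ∣ (q * s / Nat.gcd (q * s) M) * m + p / Nat.gcd (q * s) M := by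
  set g := Nat.gcd (q * s) M with hg
  have g0 : 0 < g := Nat.gcd_pos_of_pos_right _ hM
  obtain ⟨u, hu⟩ : g ∣ q * s := Nat.gcd_dvd_left _ _
  obtain ⟨v, hv⟩ : g ∣ M := Nat.gcd_dvd_right _ _
  have e : q * (s * m) = g * (u * m) := by rw [← mul_assoc, hu, mul_assoc]
  have hp : g ∣ p := by
    have h1 : g ∣ q * (s * m) + p := (Dvd.intro _ hv.symm).trans h
    rw [e] at h1
    exact (Nat.dvd_add_right (Dvd.intro _ rfl)).1 h1
  refine ⟨Nat.mod_eq_zero_of_dvd hp, ?_⟩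
  obtain ⟨w, hw⟩ := hp
  rw [hu, hv, hw, Nat.mul_div_cancel_left _ g0, Nat.mul_div_cancel_left _ g0,
    Nat.mul_div_cancel_left _ g0]
  rw [e, hv, hw, ← mul_add] at h
  exact Nat.dvd_of_mul_dvd_mul_left g0 h

/-- Passing to a factor, size part. -/
theorem factor_bound {r s cs m c c' : ℕ} (hc : c' + cs ≤ c)
    (hr : 10 ^ 6 * 3 ^ c ≤ r * (s * m) ^ 3) :
    10 ^ 6 * 3 ^ c' ≤ (r * s ^ 3 / 3 ^ cs + 1) * m ^ 3 := by
  apply div_bound (by positivity)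
  have h1 : 3 ^ (c' + cs) ≤ 3 ^ c := Nat.pow_le_pow_right (by norm_num) hc
  calc 10 ^ 6 * 3 ^ c' * 3 ^ cs = 10 ^ 6 * 3 ^ (c' + cs) := by rw [pow_add]; ring
    _ ≤ 10 ^ 6 * 3 ^ c := Nat.mul_le_mul le_rfl h1
    _ ≤ r * (s * m) ^ 3 := hr
    _ = r * s ^ 3 * m ^ 3 := by ring

theorem sum_bound {r B m c c' : ℕ} (hB : B ≤ 3) (hm : 9997 ≤ m) (hc : c' + B ≤ c)
    (hr : 10 ^ 6 * 3 ^ c ≤ r * (m + B) ^ 3) :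
    10 ^ 6 * 3 ^ c' ≤ (r * 1001 / (3 ^ B * 1000) + 1) * m ^ 3 := by
  apply div_bound (by positivity)
  have h1 : 3 ^ (c' + B) ≤ 3 ^ c := Nat.pow_le_pow_right (by norm_num) hc
  have h2 : 1000 * (m + B) ^ 3 ≤ 1001 * m ^ 3 := by
    have : (m + B) ^ 3 ≤ (m + 3) ^ 3 := Nat.pow_le_pow_left (by omega) 3
    obtain ⟨t, rfl⟩ := Nat.exists_eq_add_of_le hm
    nlinarith [sq_nonneg t, pow_nonneg (Nat.zero_le t) 3]
  calc 10 ^ 6 * 3 ^ c' * (3 ^ B * 1000) = 10 ^ 6 * 3 ^ (c' + B) * 1000 := by rw [pow_add]; ring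
    _ ≤ 10 ^ 6 * 3 ^ c * 1000 := Nat.mul_le_mul (Nat.mul_le_mul le_rfl h1) le_rfl
    _ ≤ r * (m + B) ^ 3 * 1000 := Nat.mul_le_mul hr le_rfl
    _ = r * (1000 * (m + B) ^ 3) := by ring
    _ ≤ r * (1001 * m ^ 3) := Nat.mul_le_mul le_rfl h2
    _ = r * 1001 * m ^ 3 := by ring

theorem big_bound {r a l m c c' : ℕ} (hl : 3001 ≤ 3 ^ l) (hc : c' + (2 * a + 3 * l + 1) ≤ c)
    (hr : 10 ^ 6 * 3 ^ c ≤ r * ((2 ^ a * 3 ^ l + 1) * m) ^ 3) :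
    10 ^ 6 * 3 ^ c' ≤ (r * (8 ^ a * 1001) / (3 * 9 ^ a * 1000) + 1) * m ^ 3 := by
  apply div_bound (by positivity)
  have h1 : 3 ^ (c' + (2 * a + 3 * l + 1)) ≤ 3 ^ c := Nat.pow_le_pow_right (by norm_num) hc
  have e1 : 3 ^ (c' + (2 * a + 3 * l + 1)) = 3 ^ c' * (3 * 9 ^ a) * 27 ^ l := by
    rw [pow_add, pow_add, pow_add, pow_mul, pow_mul]; norm_num; ring
  have h2 : 1000 * (2 ^ a * 3 ^ l + 1) ^ 3 ≤ 1001 * (8 ^ a * 27 ^ l) := by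
    have e2 : 8 ^ a * 27 ^ l = (2 ^ a * 3 ^ l) ^ 3 := by
      rw [mul_pow, ← pow_mul, ← pow_mul, mul_comm a, mul_comm l, pow_mul, pow_mul]; norm_num
    have h3 : 3001 ≤ 2 ^ a * 3 ^ l :=
      hl.trans (Nat.le_mul_of_pos_left _ (by positivity))
    rw [e2]
    generalize 2 ^ a * 3 ^ l = x at h3
    obtain ⟨t, rfl⟩ := Nat.exists_eq_add_of_le h3
    nlinarith [sq_nonneg t, pow_nonneg (Nat.zero_le t) 3]
  have h4 : (10 ^ 6 * 3 ^ c' * (3 * 9 ^ a * 1000)) * 27 ^ l ≤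
      (r * (8 ^ a * 1001) * m ^ 3) * 27 ^ l := by
    calc (10 ^ 6 * 3 ^ c' * (3 * 9 ^ a * 1000)) * 27 ^ l
        = 10 ^ 6 * (3 ^ c' * (3 * 9 ^ a) * 27 ^ l) * 1000 := by ring
      _ ≤ 10 ^ 6 * 3 ^ c * 1000 := by
          rw [← e1]; exact Nat.mul_le_mul (Nat.mul_le_mul le_rfl h1) le_rfl
      _ ≤ r * ((2 ^ a * 3 ^ l + 1) * m) ^ 3 * 1000 := Nat.mul_le_mul hr le_rfl
      _ = (r * m ^ 3) * (1000 * (2 ^ a * 3 ^ l + 1) ^ 3) := by ring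
      _ ≤ (r * m ^ 3) * (1001 * (8 ^ a * 27 ^ l)) := Nat.mul_le_mul le_rfl h2
      _ = (r * (8 ^ a * 1001) * m ^ 3) * 27 ^ l := by ring
  exact Nat.le_of_mul_le_mul_right h4 (by positivity)

theorem mchk_sound (f : ℕ) : ∀ q p M r n c, mchk f q p M r = true → W n c → M ∣ q * n + p →
    10 ^ 6 * 3 ^ c ≤ r * n ^ 3 → False := by
  induction f with
  | zero => intro q p M r n c h; exact absurd h (by simp [mchk])
  | succ f ih =>
    intro q p M r n c h hW hd hr
    have hn0 := hW.pos.1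
    have hn3 : 0 < n ^ 3 := Nat.pow_pos hn0
    have hcube := hW.cube
    rw [mchk_succ, Bool.or_eq_true, Bool.or_eq_true, blt_iff] at h
    rcases h with h | h | h
    · have h1 : 10 ^ 6 * n ^ 3 ≤ r * n ^ 3 := (Nat.mul_le_mul le_rfl hcube).trans hr
      have h2 := Nat.le_of_mul_le_mul_right h1 hn3
      omega
    · rw [Bool.and_eq_true, Nat.ble_eq] at h
      have h1 : r * n ^ 3 ≤ 1940000 * n ^ 3 := Nat.mul_le_mul h.1 le_rfl
      obtain ⟨a, l, ha, e, -⟩ := hW.smooth (by omega)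
      rw [e] at hd
      exact leafOk_sound h.2 ha hd
    simp only [Bool.and_eq_true, Nat.ble_eq] at h
    obtain ⟨hp, hq, hM, hr32, h1, h2, h3, hsp, hfam⟩ := h
    have hMle : M ≤ q * n + p := Nat.le_of_dvd (by omega) hd
    have hM0 : 0 < M := by omega
    have hn : 10000 ≤ n := by
      have : q * 10000 ≤ q * n := by omega
      exact Nat.le_of_mul_le_mul_left this (by omega)
    have h32 : 3 ^ c ≤ 32 * n ^ 3 := by
      have : r * n ^ 3 ≤ 32000000 * n ^ 3 := Nat.mul_le_mul hr32 le_rfl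
      omega
    rcases step hW (by omega) h32 with ⟨m, B, c', hB1, hB3, e, hc, hm⟩ |
        ⟨x, hx, m, c', e, hc, hm, h9⟩ | ⟨a, l, m, c', ha, hal, e, hc, hm, h17⟩
    · subst e
      have hb := sum_bound hB3 (by omega) hc hr
      have hd' : M ∣ q * m + (p + q * B) := by
        have e2 : q * m + (p + q * B) = q * (m + B) + p := by ring
        rw [e2]; exact hd
      interval_cases B
      · exact ih _ _ _ _ _ _ h1 hm hd' hb
      · exact ih _ _ _ _ _ _ h2 hm hd' hb
      · exact ih _ _ _ _ _ _ h3 hm hd' hb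
    · have hT : 9 ^ x.2 * 1000000 ≤ x.1 ^ 6 * r := by
        have : (9 ^ x.2 * 1000000) * n ^ 3 ≤ (x.1 ^ 6 * r) * n ^ 3 := by
          calc (9 ^ x.2 * 1000000) * n ^ 3 = 1000000 * (9 ^ x.2 * n ^ 3) := by ring
            _ ≤ 1000000 * (x.1 ^ 6 * 3 ^ c) := Nat.mul_le_mul le_rfl h9
            _ = x.1 ^ 6 * (10 ^ 6 * 3 ^ c) := by ring
            _ ≤ x.1 ^ 6 * (r * n ^ 3) := Nat.mul_le_mul le_rfl hr
            _ = (x.1 ^ 6 * r) * n ^ 3 := by ring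
        exact Nat.le_of_mul_le_mul_right this hn3
      have := sporAll_spec (T := r) (N := 1000000)
        (fun s cs hs => by rw [mul_comm, mul_comm (9 ^ cs)]; exact blt_iff.1 hs) hsp x hx hT
      rw [Bool.or_eq_true, not_beq_zero] at this
      rw [e] at hd hr
      obtain ⟨hf1, hf2⟩ := factor_dvd hM0 hd
      rcases this with h | h
      · exact h hf1
      · exact ih _ _ _ _ _ _ h hm hf2 (factor_bound hc hr)
    · have hT : 17 * 81 ^ a * 1000000 ≤ 2 * 64 ^ a * r := by
        have : (17 * 81 ^ a * 1000000) * n ^ 3 ≤ (2 * 64 ^ a * r) * n ^ 3 := by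
          calc (17 * 81 ^ a * 1000000) * n ^ 3 = 1000000 * (17 * 81 ^ a * n ^ 3) := by ring
            _ ≤ 1000000 * (2 * 64 ^ a * 3 ^ c) := Nat.mul_le_mul le_rfl h17
            _ = 2 * 64 ^ a * (10 ^ 6 * 3 ^ c) := by ring
            _ ≤ 2 * 64 ^ a * (r * n ^ 3) := Nat.mul_le_mul le_rfl hr
            _ = (2 * 64 ^ a * r) * n ^ 3 := by ring
        exact Nat.le_of_mul_le_mul_right this hn3
      rw [Bool.or_eq_true, blt_iff] at hfam
      have hg := guard_aux hT
      replace hfam := allBelow_spec (hfam.resolve_left (by omega)) a (by omega)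
      rw [Bool.or_eq_true, blt_iff] at hfam
      replace hfam := hfam.resolve_left (by omega)
      generalize (2 * Nat.log2 q + Nat.log2 M) * 100 / 475 + 5 = L1 at hfam
      simp only [Bool.and_eq_true, Nat.ble_eq] at hfam
      obtain ⟨hL, hbig, hsm⟩ := hfam
      rw [e] at hd hr
      rcases Nat.lt_or_ge l L1 with hl | hl
      · have := allBelow_spec hsm l hl
        rw [Bool.or_eq_true, Bool.or_eq_true, blt_iff, not_beq_zero] at this
        obtain ⟨hf1, hf2⟩ := factor_dvd hM0 hd
        rcases this with (h | h) | h
        · omega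
        · exact h hf1
        · exact ih _ _ _ _ _ _ h hm hf2 (factor_bound hc hr)
      · refine ih _ _ _ _ _ _ hbig hm ?_
          (big_bound (hL.trans (Nat.pow_le_pow_right (by norm_num) hl)) hc hr)
        have h4 : Nat.gcd M (2 ^ a * 3 ^ L1) ∣ q * ((2 ^ a * 3 ^ l + 1) * m) + p :=
          (Nat.gcd_dvd_left _ _).trans hd
        have h5 : Nat.gcd M (2 ^ a * 3 ^ L1) ∣ (2 ^ a * 3 ^ l) * (q * m) :=
          ((Nat.gcd_dvd_right _ _).trans (mul_dvd_mul_left _ (pow_dvd_pow 3 hl))).mul_right _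
        have e2 : q * ((2 ^ a * 3 ^ l + 1) * m) + p = (2 ^ a * 3 ^ l) * (q * m) + (q * m + p) := by
          ring
        rw [e2] at h4
        exact (Nat.dvd_add_right h5).1 h4

/-! ### The computations -/

/-- The checks for seven consecutive values of `l`. -/
def rootChunk (t : ℕ) : Bool :=
  allBelow (fun l => allBelow (fun k => rootChk k (7 * t + l)) 49) 7

theorem rootChunk_zero : rootChunk 0 = true := by decide +kernel

theorem rootChunk_one : rootChunk 1 = true := by decide +kernel

theorem rootChunk_two : rootChunk 2 = true := by decide +kernel

theorem rootChunk_three : rootChunk 3 = true := by decide +kernel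

theorem rootChunk_four : rootChunk 4 = true := by decide +kernel

theorem rootChunk_five : rootChunk 5 = true := by decide +kernel

theorem rootChunk_six : rootChunk 6 = true := by decide +kernel

theorem rootChunk_seven : rootChunk 7 = true := by decide +kernel

theorem rootChk_all {k l : ℕ} (hl : l < 56) (hk : k < 49) : rootChk k l = true := by
  have h : rootChunk (l / 7) = true := by
    have h8 : l / 7 < 8 := by omega
    interval_cases l / 7
    · exact rootChunk_zero
    · exact rootChunk_one
    · exact rootChunk_two
    · exact rootChunk_three
    · exact rootChunk_four
    · exact rootChunk_five
    · exact rootChunk_six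
    · exact rootChunk_seven
  have h1 := allBelow_spec (allBelow_spec h (l % 7) (Nat.mod_lt _ (by norm_num))) k hk
  rwa [Nat.div_add_mod] at h1

theorem mchk_one : mchk 40 1 1 (2 ^ 5 * 3 ^ 56) (95105000 * 1001 / (3 ^ 1 * 1000) + 1) = true := by
  decide +kernel

theorem mchk_two : mchk 40 1 2 (2 ^ 5 * 3 ^ 56) (95105000 * 1001 / (3 ^ 2 * 1000) + 1) = true := by
  decide +kernel

theorem mchk_three :
    mchk 40 1 3 (2 ^ 5 * 3 ^ 56) (95105000 * 1001 / (3 ^ 3 * 1000) + 1) = true := by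
  decide +kernel

theorem mchk_four : mchk 40 1 4 (2 ^ 5 * 3 ^ 56) (95105000 * 1001 / (3 ^ 4 * 1000) + 1) = true := by
  decide +kernel

theorem k_bounds : ∀ k < 49, 8 * 9 ^ k < 3 ^ 8 * 8 ^ k ∧ 1001 * 9 ^ k < 3 ^ 6 * 8 ^ k * 1000 ∧
    (1001 * 9 ^ k < 9 * 8 ^ k * 1000 ∨ 10 ≤ k) ∧ 10 ^ 6 * 9 ^ k ≤ 3 * 95105000 * 8 ^ k := by
  decide +kernel

/-! ### Conclusion -/

theorem root {k l A B i j : ℕ} (hk : k ≤ 48) (hA : W A i) (hB : W B j) (hBA : B ≤ A)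
    (e : A + B = 2 ^ k * 3 ^ l) (hij : i + j + 1 ≤ 2 * k + 3 * l) : False := by
  obtain ⟨kb1, kb2, kb3, kb4⟩ := k_bounds k (by omega)
  have hA0 := hA.pos.1
  have hB0 := hB.pos
  have h8 : 0 < 8 ^ k := by positivity
  have hA3 : 0 < A ^ 3 := Nat.pow_pos hA0
  have hcube := hA.cube
  have hN : (A + B) ^ 3 = 8 ^ k * 27 ^ l := by
    rw [e, mul_pow, ← pow_mul, ← pow_mul, mul_comm k, mul_comm l, pow_mul, pow_mul]; norm_num
  have H : (3 ^ (j + 1) * 8 ^ k) * 3 ^ i ≤ 9 ^ k * (A + B) ^ 3 := by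
    have h1 : 3 ^ (i + j + 1) ≤ 3 ^ (2 * k + 3 * l) := Nat.pow_le_pow_right (by norm_num) hij
    have e1 : 3 ^ (2 * k + 3 * l) = 9 ^ k * 27 ^ l := by
      rw [pow_add, pow_mul, pow_mul]; norm_num
    have e2 : 3 ^ (i + j + 1) = 3 ^ i * 3 ^ (j + 1) := by rw [add_assoc, pow_add]
    rw [e1, e2] at h1
    calc (3 ^ (j + 1) * 8 ^ k) * 3 ^ i = (3 ^ i * 3 ^ (j + 1)) * 8 ^ k := by ring
      _ ≤ (9 ^ k * 27 ^ l) * 8 ^ k := Nat.mul_le_mul h1 le_rfl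
      _ = 9 ^ k * (A + B) ^ 3 := by rw [hN]; ring
  have H2 : (3 ^ (j + 1) * 8 ^ k) * A ^ 3 ≤ 9 ^ k * (A + B) ^ 3 :=
    (Nat.mul_le_mul le_rfl hcube).trans H
  have hj : j + 1 < 8 := by
    have h1 : (A + B) ^ 3 ≤ (2 * A) ^ 3 := Nat.pow_le_pow_left (by omega) 3
    have h2 : (3 ^ (j + 1) * 8 ^ k) * A ^ 3 ≤ (8 * 9 ^ k) * A ^ 3 := by
      calc _ ≤ 9 ^ k * (A + B) ^ 3 := H2
        _ ≤ 9 ^ k * (2 * A) ^ 3 := Nat.mul_le_mul le_rfl h1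
        _ = _ := by ring
    have h3 := Nat.le_of_mul_le_mul_right h2 hA3
    have h4 : 3 ^ (j + 1) < 3 ^ 8 :=
      Nat.lt_of_mul_lt_mul_right (lt_of_le_of_lt h3 kb1)
    exact (Nat.pow_lt_pow_iff_right (by norm_num)).1 h4
  obtain ⟨hB10, htB⟩ := small_cost hB (by omega)
  rcases Nat.lt_or_ge l 56 with hl | hl
  · have h1 := rootChk_all hl (show k < 49 by omega)
    have h2 := allBelow_spec h1 (B - 1) (by omega)
    rw [Bool.or_eq_true, Nat.ble_eq, Nat.sub_add_cancel hB0.1] at h2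
    rcases h2 with h2 | h2
    · omega
    · refine chk_sound _ _ _ h2 ?_
      have e3 : 2 ^ k * 3 ^ l - B = A := by omega
      rw [e3]
      exact hA.mono (by omega)
  · have hbig : 3 ^ 56 ≤ A + B := by
      rw [e]
      exact (Nat.pow_le_pow_right (by norm_num) hl).trans
        (Nat.le_mul_of_pos_left _ (by positivity))
    have hA' : 100000 ≤ A := by omega
    have h1001 : 1000 * (A + B) ^ 3 ≤ 1001 * A ^ 3 := by
      have : (A + B) ^ 3 ≤ (A + 9) ^ 3 := Nat.pow_le_pow_left (by omega) 3
      obtain ⟨t, rfl⟩ := Nat.exists_eq_add_of_le hA'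
      nlinarith [sq_nonneg t, pow_nonneg (Nat.zero_le t) 3]
    have H3 : 3 ^ (j + 1) * 8 ^ k * 1000 ≤ 1001 * 9 ^ k := by
      have : (3 ^ (j + 1) * 8 ^ k * 1000) * A ^ 3 ≤ (1001 * 9 ^ k) * A ^ 3 := by
        calc _ = ((3 ^ (j + 1) * 8 ^ k) * A ^ 3) * 1000 := by ring
          _ ≤ (9 ^ k * (A + B) ^ 3) * 1000 := Nat.mul_le_mul H2 le_rfl
          _ = 9 ^ k * (1000 * (A + B) ^ 3) := by ring
          _ ≤ 9 ^ k * (1001 * A ^ 3) := Nat.mul_le_mul le_rfl h1001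
          _ = _ := by ring
      exact Nat.le_of_mul_le_mul_right this hA3
    have hk10 : 10 ≤ k := by
      refine kb3.resolve_left fun hlt => ?_
      have h9 : 3 ^ 2 ≤ 3 ^ (j + 1) := Nat.pow_le_pow_right (by norm_num) (by omega)
      have : 3 ^ 2 * 8 ^ k * 1000 ≤ 3 ^ (j + 1) * 8 ^ k * 1000 :=
        Nat.mul_le_mul (Nat.mul_le_mul h9 le_rfl) le_rfl
      omega
    have hj4 : j + 1 < 6 := by
      have h5 : 3 ^ (j + 1) * (8 ^ k * 1000) < 3 ^ 6 * (8 ^ k * 1000) := by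
        rw [← mul_assoc, ← mul_assoc]; exact lt_of_le_of_lt H3 kb2
      exact (Nat.pow_lt_pow_iff_right (by norm_num)).1 (Nat.lt_of_mul_lt_mul_right h5)
    have htb := (tbl_ge B hB10).2.2 (by omega)
    have hBj : B ≤ j := by omega
    have hdvd : 2 ^ 5 * 3 ^ 56 ∣ 1 * A + B := by
      rw [one_mul, e]
      exact mul_dvd_mul (pow_dvd_pow 2 (by omega)) (pow_dvd_pow 3 hl)
    have hr : 10 ^ 6 * 3 ^ i ≤ (95105000 * 1001 / (3 ^ B * 1000) + 1) * A ^ 3 := by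
      apply div_bound (by positivity)
      have hBp : 3 ^ B ≤ 3 ^ j := Nat.pow_le_pow_right (by norm_num) hBj
      have h6 : (3 * 8 ^ k) * (10 ^ 6 * 3 ^ i * (3 ^ B * 1000)) ≤
          (3 * 8 ^ k) * (95105000 * 1001 * A ^ 3) := by
        calc (3 * 8 ^ k) * (10 ^ 6 * 3 ^ i * (3 ^ B * 1000))
            = 3 ^ B * (3 * 8 ^ k * 10 ^ 6 * 3 ^ i * 1000) := by ring
          _ ≤ 3 ^ j * (3 * 8 ^ k * 10 ^ 6 * 3 ^ i * 1000) := Nat.mul_le_mul hBp le_rfl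
          _ = 10 ^ 6 * 1000 * ((3 ^ (j + 1) * 8 ^ k) * 3 ^ i) := by rw [pow_succ]; ring
          _ ≤ 10 ^ 6 * 1000 * (9 ^ k * (A + B) ^ 3) := Nat.mul_le_mul le_rfl H
          _ = (10 ^ 6 * 9 ^ k) * (1000 * (A + B) ^ 3) := by ring
          _ ≤ (3 * 95105000 * 8 ^ k) * (1001 * A ^ 3) := Nat.mul_le_mul kb4 h1001
          _ = _ := by ring
      exact Nat.le_of_mul_le_mul_left h6 (by positivity)
    have hB4 : B ≤ 4 := by omega
    have hB1 := hB0.1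
    interval_cases B
    · exact mchk_sound _ _ _ _ _ _ _ mchk_one hA hdvd hr
    · exact mchk_sound _ _ _ _ _ _ _ mchk_two hA hdvd hr
    · exact mchk_sound _ _ _ _ _ _ _ mchk_three hA hdvd hr
    · exact mchk_sound _ _ _ _ _ _ _ mchk_four hA hdvd hr

theorem dvd_form {a k l : ℕ} (h : a ∣ 2 ^ k * 3 ^ l) : ∃ k' l', k' ≤ k ∧ l' ≤ l ∧
    a = 2 ^ k' * 3 ^ l' := by
  obtain ⟨x, y, hx, hy, rfl⟩ := (Nat.dvd_mul).1 h
  obtain ⟨k', hk, rfl⟩ := (Nat.dvd_prime_pow Nat.prime_two).1 hx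
  obtain ⟨l', hl, rfl⟩ := (Nat.dvd_prime_pow Nat.prime_three).1 hy
  exact ⟨k', l', hk, hl, rfl⟩

theorem form_inj {k l k' l' : ℕ} (h : 2 ^ k * 3 ^ l = 2 ^ k' * 3 ^ l') : k = k' ∧ l = l' := by
  have h1 := congrArg (fun n => n.factorization 2) h
  have h2 := congrArg (fun n => n.factorization 3) h
  simp [Nat.factorization_mul, Nat.Prime.factorization Nat.prime_two,
    Nat.Prime.factorization Nat.prime_three] at h1 h2
  exact ⟨h1, h2⟩

theorem lower_bound {n c : ℕ} (h : CanWrite n c) : ∀ k l, k ≤ 48 → n = 2 ^ k * 3 ^ l →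
    2 * k + 3 * l ≤ c := by
  induction h with
  | one =>
    intro k l _ e
    have e' : 2 ^ k * 3 ^ l = 2 ^ 0 * 3 ^ 0 := by rw [← e]; norm_num
    have := form_inj e'
    omega
  | @add a b i j ha hb _ _ =>
    intro k l hk e
    by_contra hc
    rcases Nat.le_total b a with hba | hab
    · exact root hk ⟨i, le_rfl, ha⟩ ⟨j, le_rfl, hb⟩ hba e (by omega)
    · exact root hk ⟨j, le_rfl, hb⟩ ⟨i, le_rfl, ha⟩ hab (by rw [add_comm]; exact e) (by omega)
  | @mul a b i j ha hb h1 h2 =>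
    intro k l hk e
    obtain ⟨k1, l1, hk1, hl1, e1⟩ := dvd_form (Dvd.intro _ e)
    obtain ⟨k2, l2, hk2, hl2, e2⟩ := dvd_form (Dvd.intro_left _ e)
    have e3 : 2 ^ (k1 + k2) * 3 ^ (l1 + l2) = 2 ^ k * 3 ^ l := by
      rw [← e, e1, e2, pow_add, pow_add]; ring
    have e4 := form_inj e3
    have := h1 k1 l1 (by omega) e1
    have := h2 k2 l2 (by omega) e2
    omega

theorem upper_bound (k l : ℕ) (h : ¬(k = 0 ∧ l = 0)) : CanWrite (2 ^ k * 3 ^ l) (2 * k + 3 * l) := by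
  have c2 : CanWrite 2 2 := CanWrite.add CanWrite.one CanWrite.one
  have c3 : CanWrite 3 3 := CanWrite.add c2 CanWrite.one
  have p2 : ∀ k, CanWrite (2 ^ (k + 1)) (2 * (k + 1)) := by
    intro k
    induction k with
    | zero => exact c2
    | succ k ih => exact CanWrite.mul ih c2
  induction l with
  | zero =>
    obtain ⟨k', rfl⟩ := Nat.exists_eq_succ_of_ne_zero (fun hk => h ⟨hk, rfl⟩)
    simpa using p2 k'
  | succ l ih =>
    by_cases h0 : k = 0 ∧ l = 0
    · obtain ⟨rfl, rfl⟩ := h0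
      simpa using c3
    · have := CanWrite.mul (ih h0) c3
      rw [mul_assoc, ← pow_succ] at this
      exact this

theorem cpx_two_pow_three_pow (k ℓ : ℕ) (hk : k ≤ 48) (h : ¬(k = 0 ∧ ℓ = 0)) :
    cpx (2 ^ k * 3 ^ ℓ) = 2 * k + 3 * ℓ := by
  apply le_antisymm
  · exact Nat.sInf_le (upper_bound k ℓ h)
  · have hne : {c | CanWrite (2 ^ k * 3 ^ ℓ) c}.Nonempty := ⟨_, upper_bound k ℓ h⟩
    exact lower_bound (Nat.sInf_mem hne) k ℓ hk rfl
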